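/- For all non-negative integers m1, m2, m3, with indices taken cyclically modulo 3 (i.e. m_{a+3} = m_a), the following identity of rational numbers holds: ∑_{j=0}^{2} (−1)^{m_{1+j}+m_{2+j}} b(m_{1+j}, m_{2+j}; m_{3+j}) + ∑_{j=0}^{2} (−1)^{m_{3+j}} c(m_{1+j}, m_{2+j}; m_{3+j}) equals 1 if (m1,m2,m3) = (0,0,0), and equals 0 otherwise. -/

import Mathlib

open Finset

/-- `b(a, b; c) = a!·b!·c!·C(m−1, c)·B_m/m!` with `m = a+b+c+2`, Bernoulli numbers
with the convention `B_1 = 1/2` (i.e. `bernoulli'`). -/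
def bMT (a b c : ℕ) : ℚ :=
  (a.factorial : ℚ) * b.factorial * c.factorial * (a + b + c + 1).choose c *
    bernoulli' (a + b + c + 2) / (a + b + c + 2).factorial

/-- `c(a, b; d) = ∑_{n1+n2=d} C(d, n1)·(B_{a+n1+1}/(a+n1+1))·(B_{b+n2+1}/(b+n2+1))`. -/
def cMT (a b d : ℕ) : ℚ :=
  ∑ n1 ∈ Finset.range (d + 1),
    (d.choose n1 : ℚ) * (bernoulli' (a + n1 + 1) / (a + n1 + 1)) *
      (bernoulli' (b + (d - n1) + 1) / (b + (d - n1) + 1))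

open PowerSeries in
theorem auxP_rescale (c : Polynomial ℚ) :
    rescale c (bernoulli'PowerSeries (Polynomial ℚ)) * (rescale c (exp (Polynomial ℚ)) - 1)
      = PowerSeries.C c * X * rescale c (exp (Polynomial ℚ)) := by
  have h := congrArg (rescale c) (bernoulli'PowerSeries_mul_exp_sub_one (Polynomial ℚ))
  simpa [map_mul, rescale_X] using h

theorem auxB_neg (n : ℕ) : (-1 : ℚ) ^ n * bernoulli' n = bernoulli' n - if n = 1 then 1 else 0 := by
  by_cases h : n = 1
  · subst h; norm_num
  · rw [if_neg h, sub_zero]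
    rcases Nat.even_or_odd n with he | ho
    · simp [he.neg_one_pow]
    · have : 1 < n := by
        rcases ho with ⟨k, rfl⟩; omega
      simp [bernoulli'_eq_zero_of_odd ho this]

open PowerSeries in
theorem auxP_neg (c : Polynomial ℚ) :
    rescale (-c) (bernoulli'PowerSeries (Polynomial ℚ)) =
      rescale c (bernoulli'PowerSeries (Polynomial ℚ)) - PowerSeries.C c * X := by
  ext1 n
  simp only [coeff_rescale, map_sub, bernoulli'PowerSeries, coeff_mk, coeff_C_mul, coeff_X]
  have h := auxB_neg n
  have h2 : (-1 : Polynomial ℚ) ^ n * algebraMap ℚ (Polynomial ℚ) (bernoulli' n / n.factorial) =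
      algebraMap ℚ (Polynomial ℚ) (bernoulli' n / n.factorial) - if n = 1 then 1 else 0 := by
    have : ((-1 : ℚ) ^ n * bernoulli' n) / n.factorial
        = bernoulli' n / n.factorial - if n = 1 then 1 else 0 := by
      rw [h]; split_ifs with h1
      · subst h1; norm_num
      · simp
    have h3 := congrArg (algebraMap ℚ (Polynomial ℚ)) this
    rw [mul_div_assoc] at h3
    rw [map_mul, map_sub] at h3
    split_ifs at h3 ⊢ <;> simpa using h3
  rw [neg_pow, mul_right_comm, h2]
  by_cases hn : n = 1
  · subst hn; simp; ring
  · simp [hn]; ring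

theorem aux_cancel {R : Type*} [CommRing R] [IsDomain R] (x t u v w e f : R)
    (he : e - 1 ≠ 0) (hf : f - 1 ≠ 0) (hg : e * f - 1 ≠ 0)
    (hu : u * (e - 1) = t * e) (hv : v * (f - 1) = (x - 1) * t * f)
    (hw : w * (e * f - 1) = x * t * (e * f)) :
    (x - 1) * (w - 1) * (u - 1) + (v - (x - 1) * t - 1) * (w - x * t - 1)
      - x * (u - t - 1) * (v - 1) + x * w - u - (x - 1) * v
       = x * (x - 1) * t ^ 2 + (x - 1) * t := by
  apply mul_left_cancel₀ (mul_ne_zero (mul_ne_zero he hf) hg)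
  linear_combination (x - 1) * (f - 1) * (w * (e * f - 1) * hu + t * e * hw)
    + (e - 1) * (w * (e * f - 1) * hv + (x - 1) * t * f * hw)
    - x * (e * f - 1) * (v * (f - 1) * hu + t * e * hv)
    - (x - 1) * t * (e - 1) * (f - 1) * hw

/-- `B_{n+1}/(n+1)`. -/
def beMT (n : ℕ) : ℚ := bernoulli' (n + 1) / (n + 1)

theorem cMT_eq (a b d : ℕ) : cMT a b d =
    ∑ p ∈ antidiagonal d, (d.choose p.1 : ℚ) * (beMT (a + p.1) * beMT (b + p.2)) := by
  rw [Finset.Nat.sum_antidiagonal_eq_sum_range_succ_mk]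
  unfold cMT beMT
  refine Finset.sum_congr rfl fun k hk => ?_
  have : k ≤ d := by simp at hk; omega
  push_cast [this]
  ring

theorem cMT_succ (a b d : ℕ) : cMT a b (d + 1) = cMT (a + 1) b d + cMT a (b + 1) d := by
  simp only [cMT_eq]
  rw [Finset.sum_antidiagonal_choose_succ_mul (fun i j => beMT (a + i) * beMT (b + j))]
  rw [add_comm]
  congr 1
  · refine Finset.sum_congr rfl fun p hp => ?_
    rw [Finset.HasAntidiagonal.mem_antidiagonal] at hp
    rw [Nat.choose_symm_of_eq_add hp.symm]
    ring_nf
  · refine Finset.sum_congr rfl fun p hp => ?_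
    ring_nf

theorem bMT_eq (a b c : ℕ) : bMT a b c =
    (a.factorial : ℚ) * b.factorial / (a + b + 1).factorial *
      (bernoulli' (a + b + c + 2) / (a + b + c + 2)) := by
  unfold bMT
  have h := Nat.choose_mul_factorial_mul_factorial (n := a + b + c + 1) (k := c) (by omega)
  rw [show a + b + c + 1 - c = a + b + 1 by omega] at h
  have h' : ((a + b + c + 1).choose c : ℚ) * c.factorial * (a + b + 1).factorial
    = (a + b + c + 1).factorial := by exact_mod_cast h
  have h2 : ((a + b + c + 2).factorial : ℚ) = (a + b + c + 2) * (a + b + c + 1).factorial := by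
    rw [Nat.factorial_succ (a + b + c + 1)]; push_cast; ring
  have h3 : ((a + b + 1).factorial : ℚ) ≠ 0 := by positivity
  have h4 : ((a + b + c + 1).factorial : ℚ) ≠ 0 := by positivity
  have h5 : (a + b + c + 2 : ℚ) ≠ 0 := by positivity
  have h6 : ((a + b + c + 1).choose c : ℚ) * c.factorial
    = (a + b + c + 1).factorial / (a + b + 1).factorial := by
    rw [eq_div_iff h3, h']
  rw [h2, mul_assoc _ (c.factorial : ℚ), mul_comm (c.factorial : ℚ), h6]
  field_simp

theorem bMT_succ (a b c : ℕ) : bMT a b (c + 1) = bMT (a + 1) b c + bMT a (b + 1) c := by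
  simp only [bMT_eq]
  rw [show a + 1 + b + c + 2 = a + b + c + 3 by ring, show a + (b + 1) + c + 2 = a + b + c + 3 by ring,
    show a + b + (c + 1) + 2 = a + b + c + 3 by ring, show a + 1 + b + 1 = a + b + 1 + 1 by ring,
    show a + (b + 1) + 1 = a + b + 1 + 1 by ring]
  simp only [Nat.factorial_succ]
  push_cast
  have h3 : ((a + b).factorial : ℚ) ≠ 0 := by positivity
  have h5 : (a + b + c + 3 : ℚ) ≠ 0 := by positivity
  have h6 : (a + b + 1 + 1 : ℚ) ≠ 0 := by positivity
  have h7 : (a + b + 1 : ℚ) ≠ 0 := by positivity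
  rw [show (a + 1 + b + c + 2 : ℚ) = a + b + c + 3 by ring,
    show (a + (b + 1) + c + 2 : ℚ) = a + b + c + 3 by ring,
    show (a + b + (c + 1) + 2 : ℚ) = a + b + c + 3 by ring]
  field_simp
  ring

/-- The left-hand side. -/
def sMT (m1 m2 m3 : ℕ) : ℚ :=
    ((-1 : ℚ) ^ (m1 + m2) * bMT m1 m2 m3 + (-1 : ℚ) ^ (m2 + m3) * bMT m2 m3 m1 +
        (-1 : ℚ) ^ (m3 + m1) * bMT m3 m1 m2) +
      ((-1 : ℚ) ^ m3 * cMT m1 m2 m3 + (-1 : ℚ) ^ m1 * cMT m2 m3 m1 +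
        (-1 : ℚ) ^ m2 * cMT m3 m1 m2)

theorem sMT_succ (a b c : ℕ) : sMT a b (c + 1) = - sMT (a + 1) b c - sMT a (b + 1) c := by
  simp only [sMT, cMT_succ, bMT_succ, pow_add, pow_one]
  ring

/-- Coefficient polynomial for the `b` terms. -/
noncomputable def qMT (N : ℕ) : Polynomial ℚ :=
  ∑ a ∈ range (N + 1), Polynomial.C (1 + (-1) ^ (N - a) * ((N + 1).choose a : ℚ)
    + (-1) ^ a * ((N + 1).choose (a + 1) : ℚ)) * Polynomial.X ^ a

open Polynomial in
theorem qMT_mul (N : ℕ) (hN : Even N) :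
    (X * (X - 1)) * qMT N = (X ^ (N + 3) - 1 - (X - 1) ^ (N + 3) : Polynomial ℚ) := by
  have h1 : (∑ a ∈ range (N + 1), (X : Polynomial ℚ) ^ a) * (X - 1) = X ^ (N + 1) - 1 :=
    geom_sum_mul _ _
  have h2 : ∑ a ∈ range (N + 1), (C ((-1) ^ (N - a) * ((N + 1).choose a : ℚ)) * X ^ a : Polynomial ℚ)
      = X ^ (N + 1) - (X - 1) ^ (N + 1) := by
    rw [sub_eq_add_neg X 1, add_pow, Finset.sum_range_succ _ (N + 1)]
    have : ∀ s : Polynomial ℚ, X ^ (N + 1) - (s + X ^ (N + 1) * (-1) ^ (N + 1 - (N + 1)) *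
        ((N + 1).choose (N + 1) : Polynomial ℚ)) = - s := by
      intro s; simp
    rw [this, ← Finset.sum_neg_distrib]
    refine Finset.sum_congr rfl fun a ha => ?_
    have : a ≤ N := by simp at ha; omega
    rw [Nat.sub_add_comm this, pow_succ]
    simp
    ring
  have h3 : X * ∑ a ∈ range (N + 1),
      (C ((-1) ^ a * ((N + 1).choose (a + 1) : ℚ)) * X ^ a : Polynomial ℚ)
      = 1 + (X - 1) ^ (N + 1) := by
    have : (X - 1 : Polynomial ℚ) ^ (N + 1) = - (-X + 1) ^ (N + 1) := by
      rw [show (X - 1 : Polynomial ℚ) = -(-X + 1) by ring, hN.add_one.neg_pow]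
    rw [this, add_pow, Finset.sum_range_succ' _ (N + 1), Finset.mul_sum]
    have : ∀ s : Polynomial ℚ, 1 + -(s + (-X) ^ 0 * 1 ^ (N + 1 - 0) *
        ((N + 1).choose 0 : Polynomial ℚ)) = - s := by
      intro s; simp
    rw [this, ← Finset.sum_neg_distrib]
    refine Finset.sum_congr rfl fun a ha => ?_
    rw [neg_pow]
    simp
    ring
  have h4 : qMT N = (∑ a ∈ range (N + 1), (X : Polynomial ℚ) ^ a) +
    (∑ a ∈ range (N + 1), (C ((-1) ^ (N - a) * ((N + 1).choose a : ℚ)) * X ^ a : Polynomial ℚ)) +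
    ∑ a ∈ range (N + 1),
      (C ((-1) ^ a * ((N + 1).choose (a + 1) : ℚ)) * X ^ a : Polynomial ℚ) := by
    rw [qMT, ← Finset.sum_add_distrib, ← Finset.sum_add_distrib]
    refine Finset.sum_congr rfl fun a ha => ?_
    simp only [C_add, C_1]
    ring
  rw [h4, h2]
  linear_combination X * h1 + (X - 1) * h3

theorem qMT_coeff (a b : ℕ) : (qMT (a + b)).coeff a = 1 + (-1) ^ b * ((a + b + 1).choose a : ℚ)
    + (-1) ^ a * ((a + b + 1).choose (a + 1) : ℚ) := by
  rw [qMT, Polynomial.finsetSum_coeff]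
  simp only [Polynomial.coeff_C_mul_X_pow]
  rw [Finset.sum_ite_eq]
  simp


/-- Generating series of `beMT`. -/
noncomputable def fMT : PowerSeries (Polynomial ℚ) :=
  PowerSeries.mk fun n => algebraMap ℚ (Polynomial ℚ) (beMT n / n.factorial)

open PowerSeries in
theorem fMT_rescale (c : Polynomial ℚ) :
    PowerSeries.C c * X * rescale c fMT =
      rescale c (bernoulli'PowerSeries (Polynomial ℚ)) - 1 := by
  have h : X * fMT = bernoulli'PowerSeries (Polynomial ℚ) - 1 := by
    ext1 n
    cases n with
    | zero => simp [bernoulli'PowerSeries]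
    | succ n =>
      rw [mul_comm, coeff_succ_mul_X]
      simp only [fMT, bernoulli'PowerSeries, map_sub, coeff_mk, coeff_one, beMT]
      rw [if_neg (by omega), sub_zero]
      congr 1
      rw [Nat.factorial_succ]
      push_cast
      rw [div_div]
  have h2 := congrArg (rescale c) h
  simpa [rescale_X] using h2

/-- Generating series of the `b` terms. -/
noncomputable def dMT : PowerSeries (Polynomial ℚ) :=
  PowerSeries.mk fun n =>
    algebraMap ℚ (Polynomial ℚ) (bernoulli' (n + 2) / (n + 2).factorial) * qMT n

open PowerSeries in
theorem dMT_mul (x : Polynomial ℚ) (hx : x = Polynomial.X) :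
    PowerSeries.C (x * (x - 1)) * dMT * X ^ 2 =
      PowerSeries.C x * rescale x (bernoulli'PowerSeries (Polynomial ℚ))
      - rescale 1 (bernoulli'PowerSeries (Polynomial ℚ))
      - PowerSeries.C (x - 1) * rescale (x - 1) (bernoulli'PowerSeries (Polynomial ℚ))
      - PowerSeries.C (x - 1) * X := by
  ext1 n
  simp only [map_sub, coeff_C_mul, coeff_rescale, coeff_mul_X_pow', bernoulli'PowerSeries, coeff_mk,
    coeff_X, sub_mul]
  rcases n with _ | _ | N
  · simp
  · have h2 : (algebraMap ℚ (Polynomial ℚ)) (1 / 2) * 2 = 1 := by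
      rw [← map_ofNat (algebraMap ℚ (Polynomial ℚ)) 2, ← map_mul]; norm_num
    simp
    simp at h2
    linear_combination (1 - x) * h2
  · simp
    rw [dMT, coeff_mk, Polynomial.algebraMap_eq]
    rcases Nat.even_or_odd N with he | ho
    · have hq := qMT_mul N he
      rw [← hx] at hq
      linear_combination Polynomial.C (bernoulli' (N + 2) / (N + 2).factorial) * hq
    · have : bernoulli' (N + 2) = 0 := bernoulli'_eq_zero_of_odd (by
        rcases ho with ⟨k, rfl⟩; exact ⟨k + 1, by ring⟩) (by omega)
      simp [this]

open PowerSeries in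
theorem exp_rescale_ne (c : Polynomial ℚ) (hc : c ≠ 0) : rescale c (exp (Polynomial ℚ)) - 1 ≠ 0 := by
  intro h
  have := congrArg (coeff 1) h
  simp [coeff_rescale, coeff_one] at this
  exact hc this

open PowerSeries in
theorem main_series (x : Polynomial ℚ) (hx : x = Polynomial.X) :
    rescale x fMT * rescale 1 fMT + rescale (1 - x) fMT * rescale (-x) fMT
      + rescale (-1) fMT * rescale (x - 1) fMT + dMT = 1 := by
  have hx0 : x ≠ 0 := hx ▸ Polynomial.X_ne_zero
  have hx1 : x - 1 ≠ 0 := by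
    rw [hx, ← Polynomial.C_1]; exact Polynomial.X_sub_C_ne_zero _
  have hexp : rescale x (exp (Polynomial ℚ)) =
      rescale 1 (exp (Polynomial ℚ)) * rescale (x - 1) (exp (Polynomial ℚ)) := by
    rw [exp_mul_exp_eq_exp_add]; congr 2; ring
  have hw := auxP_rescale x
  rw [hexp] at hw
  have hu := auxP_rescale 1
  have hv := auxP_rescale (x - 1)
  have hg := exp_rescale_ne x hx0
  rw [hexp] at hg
  have hC1 : PowerSeries.C (x - 1) = PowerSeries.C x - 1 := by simp
  rw [hC1] at hv
  have key := aux_cancel (PowerSeries.C x) X _ _ _ _ _ (exp_rescale_ne 1 one_ne_zero)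
    (exp_rescale_ne _ hx1) hg (by rw [hu, map_one, one_mul]) hv hw
  have f1 := fMT_rescale x
  have f2 := fMT_rescale 1
  have f3 := fMT_rescale (1 - x)
  have f4 := fMT_rescale (-x)
  have f5 := fMT_rescale (-1)
  have f6 := fMT_rescale (x - 1)
  have hd := dMT_mul x hx
  rw [show 1 - x = -(x - 1) by ring, auxP_neg] at f3
  rw [auxP_neg] at f4 f5
  have hx2 : PowerSeries.C x ≠ 0 := by
    rw [Ne, ← map_zero PowerSeries.C, PowerSeries.C_injective.eq_iff]; exact hx0
  have hx3 : PowerSeries.C x - 1 ≠ 0 := by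
    rw [← hC1, Ne, ← map_zero PowerSeries.C, PowerSeries.C_injective.eq_iff]; exact hx1
  rw [show 1 - x = -(x - 1) by ring]
  simp only [map_neg, map_mul, hC1, map_one] at f1 f2 f3 f4 f5 f6 hd
  apply mul_left_cancel₀ (mul_ne_zero (mul_ne_zero hx2 hx3) (pow_ne_zero 2 (X_ne_zero (R := Polynomial ℚ))))
  generalize rescale x fMT = F1 at *
  generalize rescale 1 fMT = F2 at *
  generalize rescale (-(x - 1)) fMT = F3 at *
  generalize rescale (-x) fMT = F4 at *
  generalize rescale (-1) fMT = F5 at *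
  generalize rescale (x - 1) fMT = F6 at *
  generalize rescale x (bernoulli'PowerSeries (Polynomial ℚ)) = w at *
  generalize rescale 1 (bernoulli'PowerSeries (Polynomial ℚ)) = u at *
  generalize rescale (x - 1) (bernoulli'PowerSeries (Polynomial ℚ)) = v at *
  generalize PowerSeries.C x = c at *
  generalize (X : PowerSeries (Polynomial ℚ)) = t at *
  linear_combination key + hd + (c - 1) * (t * F2 * f1 + (w - 1) * f2)
    + (-c * t * F4 * f3 + (v - (c - 1) * t - 1) * f4)
    - c * ((c - 1) * t * F6 * f5 + (u - t - 1) * f6)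

open PowerSeries in
theorem coeff_ff (c d : Polynomial ℚ) (N : ℕ) :
    coeff N (rescale c fMT * rescale d fMT) =
      ∑ p ∈ antidiagonal N, Polynomial.C (beMT p.1 / p.1.factorial * (beMT p.2 / p.2.factorial)) *
        (c ^ p.1 * d ^ p.2) := by
  rw [coeff_mul]
  refine Finset.sum_congr rfl fun p hp => ?_
  simp only [coeff_rescale, fMT, coeff_mk, Polynomial.algebraMap_eq, Polynomial.C_mul]
  ring

open Polynomial in
theorem coeff_t1 (a b : ℕ) :
    (PowerSeries.coeff (a + b) (PowerSeries.rescale X fMT * PowerSeries.rescale 1 fMT)).coeff a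
      = beMT a * beMT b / (a.factorial * b.factorial) := by
  rw [coeff_ff, finsetSum_coeff, Finset.sum_eq_single (a, b)]
  · rw [one_pow, mul_one, coeff_C_mul, coeff_X_pow, if_pos rfl]
    field_simp
  · rintro ⟨i, j⟩ h hne
    rw [Finset.HasAntidiagonal.mem_antidiagonal] at h
    have : a ≠ i := by
      rintro rfl
      apply hne
      simp at h
      simp [h]
    rw [one_pow, mul_one, coeff_C_mul, coeff_X_pow, if_neg this, mul_zero]
  · intro h
    simp at h

open Polynomial in
theorem coeff_t3 (a b : ℕ) :
    (PowerSeries.coeff (a + b) (PowerSeries.rescale (-1) fMT *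
      PowerSeries.rescale (X - 1) fMT)).coeff a
      = (-1) ^ b * cMT 0 a b / (a.factorial * b.factorial) := by
  rw [coeff_ff, finsetSum_coeff, cMT_eq, Finset.Nat.sum_antidiagonal_eq_sum_range_succ_mk,
    Finset.Nat.sum_antidiagonal_eq_sum_range_succ_mk, Finset.mul_sum, Finset.sum_div]
  symm
  apply Finset.sum_subset_zero_on_sdiff
  · intro i; simp; omega
  · intro i hi
    simp at hi
    have : (X - 1 : Polynomial ℚ).natDegree = 1 := by
      rw [← C_1]; exact natDegree_X_sub_C _
    rw [coeff_C_mul, ← C_1, ← C_neg, ← C_pow, coeff_C_mul, C_1, coeff_eq_zero_of_natDegree_lt, mul_zero, mul_zero]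
    rw [natDegree_pow, this]
    omega
  · intro i hi
    have hi' : i ≤ b := by simp at hi; omega
    obtain ⟨k, rfl⟩ := Nat.exists_eq_add_of_le hi'
    rw [show a + (i + k) - i = a + k by omega, show i + k - i = k by omega]
    rw [coeff_C_mul, ← C_1, ← C_neg, ← C_pow, coeff_C_mul, sub_eq_add_neg, ← C_neg,
      coeff_X_add_C_pow]
    rw [show a + k - a = k by omega, zero_add]
    have h1 : ((a + k).choose a : ℚ) = (a + k).factorial / (a.factorial * k.factorial) := by
      rw [Nat.cast_choose ℚ (by omega)]; simp
    have h2 : ((i + k).choose i : ℚ) = (i + k).factorial / (i.factorial * k.factorial) := by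
      rw [Nat.cast_choose ℚ (by omega)]; simp
    rw [h1, h2, pow_add]
    have := Nat.factorial_ne_zero (a + k)
    have := Nat.factorial_ne_zero (i + k)
    field_simp

theorem cMT_symm (a b d : ℕ) : cMT a b d = cMT b a d := by
  rw [cMT_eq, cMT_eq, ← Finset.Nat.sum_antidiagonal_swap]
  refine Finset.sum_congr rfl fun p hp => ?_
  rw [Finset.HasAntidiagonal.mem_antidiagonal] at hp
  rw [Prod.fst_swap, Prod.snd_swap, Nat.choose_symm_of_eq_add (b := p.2) (a := p.1) hp.symm]
  ring

open Polynomial in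
theorem coeff_t2 (a b : ℕ) :
    (PowerSeries.coeff (a + b) (PowerSeries.rescale (1 - X) fMT *
      PowerSeries.rescale (-X) fMT)).coeff a
      = (-1) ^ a * cMT b 0 a / (a.factorial * b.factorial) := by
  rw [mul_comm, cMT_symm, coeff_ff, finsetSum_coeff, cMT_eq,
    Finset.Nat.sum_antidiagonal_eq_sum_range_succ_mk,
    Finset.Nat.sum_antidiagonal_eq_sum_range_succ_mk, Finset.mul_sum, Finset.sum_div]
  symm
  have hX : ∀ i : ℕ, (-X : Polynomial ℚ) ^ i = C ((-1) ^ i) * X ^ i := by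
    intro i; rw [neg_pow]; simp
  have h1X : ∀ i : ℕ, (1 - X : Polynomial ℚ) ^ i = C ((-1) ^ i) * (X + C (-1)) ^ i := by
    intro i
    rw [show (1 - X : Polynomial ℚ) = -(X + C (-1)) by simp [sub_eq_add_neg], neg_pow]; simp
  apply Finset.sum_subset_zero_on_sdiff
  · intro i; simp; omega
  · intro i hi
    simp at hi
    rw [coeff_C_mul, hX, mul_assoc (C _), coeff_C_mul, coeff_X_pow_mul', if_neg (by omega), mul_zero, mul_zero]
  · intro i hi
    have hi' : i ≤ a := by simp at hi; omega
    obtain ⟨k, rfl⟩ := Nat.exists_eq_add_of_le hi'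
    rw [show i + k + b - i = k + b by omega, show i + k - i = k by omega]
    rw [coeff_C_mul, hX, mul_assoc (C _), coeff_C_mul, coeff_X_pow_mul', if_pos hi', h1X, coeff_C_mul,
      coeff_X_add_C_pow]
    rw [show i + k - i = k by omega, show k + b - k = b by omega, zero_add]
    have h1 : ((k + b).choose k : ℚ) = (k + b).factorial / (k.factorial * b.factorial) := by
      rw [Nat.cast_choose ℚ (by omega)]; simp
    have h2 : ((i + k).choose i : ℚ) = (i + k).factorial / (i.factorial * k.factorial) := by
      rw [Nat.cast_choose ℚ (by omega)]; simp
    rw [h1, h2, pow_add, pow_add]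
    have := Nat.factorial_ne_zero (k + b)
    have := Nat.factorial_ne_zero (i + k)
    have h3 : (-1 : ℚ) ^ b * (-1) ^ b = 1 := by rw [← mul_pow]; simp
    rw [add_comm b k]
    field_simp
    linear_combination -(beMT i * beMT (k + b)) * h3

theorem sMT_zero (a b : ℕ) : sMT a b 0 = if a = 0 ∧ b = 0 then 1 else 0 := by
  have h := congrArg (fun s => (PowerSeries.coeff (a + b) s).coeff a) (main_series _ rfl)
  simp only [map_add, Polynomial.coeff_add, coeff_t1, coeff_t2, coeff_t3] at h
  rw [dMT, PowerSeries.coeff_mk, Polynomial.algebraMap_eq, Polynomial.coeff_C_mul, qMT_coeff,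
    PowerSeries.coeff_one] at h
  have hr : (if a + b = 0 then (1 : Polynomial ℚ) else 0).coeff a = if a = 0 ∧ b = 0 then 1 else 0 := by
    by_cases h0 : a + b = 0
    · have : a = 0 := by omega
      have : b = 0 := by omega
      subst a b
      simp
    · rw [if_neg h0, if_neg (by omega)]; simp
  rw [hr] at h
  have hR : (if a = 0 ∧ b = 0 then (1 : ℚ) else 0) * (a.factorial * b.factorial) =
      if a = 0 ∧ b = 0 then 1 else 0 := by
    split_ifs with h0
    · simp [h0.1, h0.2]
    · simp
  rw [← hR, ← h, sMT]
  have hc : cMT a b 0 = beMT a * beMT b := by simp [cMT_eq]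
  rw [hc]
  have hB : (-1 : ℚ) ^ (a + b) * bernoulli' (a + b + 2) = bernoulli' (a + b + 2) := by
    have := auxB_neg (a + b + 2)
    rw [if_neg (by omega), sub_zero, pow_add] at this
    simpa using this
  simp only [bMT_eq]
  rw [Nat.cast_choose ℚ (show a ≤ a + b + 1 by omega),
    Nat.cast_choose ℚ (show a + 1 ≤ a + b + 1 by omega),
    show a + b + 1 - a = b + 1 by omega, show a + b + 1 - (a + 1) = b by omega]
  have e1 : b + a + 2 = a + b + 2 := by omega
  simp only [add_zero, zero_add, Nat.factorial_zero, e1, Nat.cast_zero, Nat.cast_one]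
  rw [Nat.factorial_succ (a + b + 1)]
  push_cast
  have n1 : ((a + b + 1).factorial : ℚ) ≠ 0 := by positivity
  have n2 : ((a + 1).factorial : ℚ) ≠ 0 := by positivity
  have n3 : ((b + 1).factorial : ℚ) ≠ 0 := by positivity
  have n4 : (a.factorial : ℚ) ≠ 0 := by positivity
  have n5 : (b.factorial : ℚ) ≠ 0 := by positivity
  have n6 : (a + b + 2 : ℚ) ≠ 0 := by positivity
  rw [show (a + b + 1 + 1 : ℚ) = a + b + 2 by ring, show (b + a + 2 : ℚ) = a + b + 2 by ring]
  generalize bernoulli' (a + b + 2) = B at *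
  have : (-1 : ℚ) ^ (a + b) * (a.factorial * b.factorial / (a + b + 1).factorial * (B / (a + b + 2)))
    = a.factorial * b.factorial / (a + b + 1).factorial * (B / (a + b + 2)) := by
    linear_combination (a.factorial * b.factorial / (a + b + 1).factorial / (a + b + 2) : ℚ) * hB
  rw [this]
  field_simp
  ring

theorem sMT_all (m3 : ℕ) : ∀ m1 m2 : ℕ, sMT m1 m2 m3 = if (m1, m2, m3) = (0, 0, 0) then 1 else 0 := by
  induction m3 with
  | zero => intro a b; rw [sMT_zero]; simp
  | succ n ih => intro a b; rw [sMT_succ, ih, ih]; simp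

theorem stmt0 (m1 m2 m3 : ℕ) :
    ((-1 : ℚ) ^ (m1 + m2) * bMT m1 m2 m3 + (-1 : ℚ) ^ (m2 + m3) * bMT m2 m3 m1 +
        (-1 : ℚ) ^ (m3 + m1) * bMT m3 m1 m2) +
      ((-1 : ℚ) ^ m3 * cMT m1 m2 m3 + (-1 : ℚ) ^ m1 * cMT m2 m3 m1 +
        (-1 : ℚ) ^ m2 * cMT m3 m1 m2) =
      if (m1, m2, m3) = (0, 0, 0) then 1 else 0 := by
  exact sMT_all m3 m1 m2
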